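/- Define on the tetrahedron the lowest-order Nédélec-type H(curl) shape functions v^IV_{jk}(x,y,z) = (1, η/2, η/4) ((1−χ)/2) P̂_j^{1}(χ) ((1−z)/2)^{j+1} P̂_k^{2j+3}(z) for integers j, k ≥ 1, where η = 4x/(1−2y−z) and χ = 2y/(1−z). Then for all integers j, k ≥ 1, l ≥ 2, m, n ≥ 1 and every type s ∈ {I, II, III}: ∫_▲ v^IV_{jk}(x,y,z) · b̃^s_{lmn}(x,y,z) dx dy dz = 0. -/

import Mathlib

open MeasureTheory

/-- Jacobi polynomial `P_n^{(a,b)}` via the Rodrigues formula (on `(-1,1)`). -/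
noncomputable def jacobiP (n a b : ℕ) (x : ℝ) : ℝ :=
  (1 / ((2:ℝ)^n * (Nat.factorial n : ℝ) * (1 - x)^a * (1 + x)^b)) *
    iteratedDeriv n (fun t : ℝ => (1 - t)^a * (1 + t)^b * (t^2 - 1)^n) x

/-- Legendre polynomial `L_n = P_n^{(0,0)}`. -/
noncomputable def legendreP (n : ℕ) (x : ℝ) : ℝ := jacobiP n 0 0 x

/-- Integrated Jacobi polynomial `P̂_n^a(x) = ∫_{-1}^x P_{n-1}^{(a,0)}(t) dt`. -/
noncomputable def intJacobiP (n a : ℕ) (x : ℝ) : ℝ :=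
  ∫ t in (-1:ℝ)..x, jacobiP (n - 1) a 0 t

/-- Integrated Legendre polynomial `L̂_n`. -/
noncomputable def intLegendreP (n : ℕ) (x : ℝ) : ℝ := intJacobiP n 0 x

/-- The open reference tetrahedron with vertices `(-1,-1,-1)`, `(1,-1,-1)`,
`(0,1,-1)`, `(0,0,1)`. -/
def Tet : Set (ℝ × ℝ × ℝ) :=
  {p | -1 < p.2.2 ∧ p.2.2 < 1 ∧ |p.2.1| < (1 - p.2.2) / 2 ∧
       |p.1| < (1 - 2*p.2.1 - p.2.2) / 4}

/-- Euclidean dot product in `ℝ³`. -/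
def dot3 (p q : ℝ × ℝ × ℝ) : ℝ := p.1 * q.1 + p.2.1 * q.2.1 + p.2.2 * q.2.2

/-- The collapsed coordinate `η = 4x/(1-2y-z)`. -/
noncomputable def etaT (p : ℝ × ℝ × ℝ) : ℝ := 4*p.1 / (1 - 2*p.2.1 - p.2.2)

/-- The collapsed coordinate `χ = 2y/(1-z)`. -/
noncomputable def chiT (p : ℝ × ℝ × ℝ) : ℝ := 2*p.2.1 / (1 - p.2.2)

/-- Auxiliary `H(curl)` interior field `ṽ^I_{ijk} = (∇f_i) g_{ij} h_{ijk}` on the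
tetrahedron. -/
noncomputable def vtTetI (i j k : ℕ) (p : ℝ × ℝ × ℝ) : ℝ × ℝ × ℝ :=
  (legendreP (i-1) (etaT p) * (((1 - chiT p)/2)^(i-1) * ((1 - p.2.2)/2)^(i-1) *
      intJacobiP j (2*i) (chiT p) * ((1 - p.2.2)/2)^j * intJacobiP k (2*i+2*j) p.2.2),
   (1/2) * legendreP (i-2) (etaT p) * (((1 - chiT p)/2)^(i-1) * ((1 - p.2.2)/2)^(i-1) *
      intJacobiP j (2*i) (chiT p) * ((1 - p.2.2)/2)^j * intJacobiP k (2*i+2*j) p.2.2),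
   (1/4) * legendreP (i-2) (etaT p) * (((1 - chiT p)/2)^(i-1) * ((1 - p.2.2)/2)^(i-1) *
      intJacobiP j (2*i) (chiT p) * ((1 - p.2.2)/2)^j * intJacobiP k (2*i+2*j) p.2.2))

/-- Auxiliary `H(curl)` interior field `ṽ^II_{ijk} = f_i (∇g_{ij}) h_{ijk}` on the
tetrahedron. -/
noncomputable def vtTetII (i j k : ℕ) (p : ℝ × ℝ × ℝ) : ℝ × ℝ × ℝ :=
  (0,
   jacobiP (j-1) (2*i) 0 (chiT p) * (((1 - p.2.2)/2)^(j-1) * intLegendreP i (etaT p) *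
      ((1 - chiT p)/2)^i * ((1 - p.2.2)/2)^i * intJacobiP k (2*i+2*j) p.2.2),
   ((chiT p/2) * jacobiP (j-1) (2*i) 0 (chiT p) - ((j:ℝ)/2) * intJacobiP j (2*i) (chiT p)) *
     (((1 - p.2.2)/2)^(j-1) * intLegendreP i (etaT p) *
      ((1 - chiT p)/2)^i * ((1 - p.2.2)/2)^i * intJacobiP k (2*i+2*j) p.2.2))

/-- Auxiliary `H(curl)` interior field `ṽ^III_{ijk} = f_i g_{ij} ∇h_{ijk}` on the
tetrahedron. -/
noncomputable def vtTetIII (i j k : ℕ) (p : ℝ × ℝ × ℝ) : ℝ × ℝ × ℝ :=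
  (0, 0,
   jacobiP (k-1) (2*i+2*j) 0 p.2.2 * (intLegendreP i (etaT p) * ((1 - chiT p)/2)^i *
      ((1 - p.2.2)/2)^i * intJacobiP j (2*i) (chiT p) * ((1 - p.2.2)/2)^j))

/-- The auxiliary polynomial `Q^{l,m}_1`. -/
noncomputable def Qtet1 (l m : ℕ) (x : ℝ) : ℝ :=
  jacobiP (m-1) (2*l-1) 1 x + ((m:ℝ) / (2*(l:ℝ) + (m:ℝ) - 1)) * jacobiP (m-1) (2*l) 0 x

/-- The auxiliary polynomial `Q^{l,m}_2`. -/
noncomputable def Qtet2 (l m : ℕ) (x : ℝ) : ℝ :=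
  -(x/2) * jacobiP (m-1) (2*l-1) 1 x +
    ((m:ℝ) / (2*(l:ℝ) + (m:ℝ) - 1)) * ((1 - x)/2) * jacobiP (m-1) (2*l) 0 x

/-- Dual candidate `b̃^I_{lmn}` on the tetrahedron. -/
noncomputable def btTetI (l m n : ℕ) (p : ℝ × ℝ × ℝ) : ℝ × ℝ × ℝ :=
  (legendreP (l-1) (etaT p) * ((1 - chiT p)/2)^(l-1) * jacobiP (m-1) (2*l-1) 1 (chiT p) *
     (((1 - p.2.2)/2)^(l+m-2) * jacobiP (n-1) (2*l+2*m-1) 1 p.2.2),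
   0, 0)

/-- Dual candidate `b̃^II_{lmn}` on the tetrahedron. -/
noncomputable def btTetII (l m n : ℕ) (p : ℝ × ℝ × ℝ) : ℝ × ℝ × ℝ :=
  (((l:ℝ) + 1) * jacobiP (l-1) 1 1 (etaT p) * (((1 - chiT p)/2)^(l-1) *
      jacobiP (m-1) (2*l) 0 (chiT p) * ((1 - p.2.2)/2)^(l+m-2) *
      jacobiP (n-1) (2*l+2*m-1) 1 p.2.2),
   -2*(l:ℝ) * jacobiP (l-2) 1 1 (etaT p) * (((1 - chiT p)/2)^(l-1) *
      jacobiP (m-1) (2*l) 0 (chiT p) * ((1 - p.2.2)/2)^(l+m-2) *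
      jacobiP (n-1) (2*l+2*m-1) 1 p.2.2),
   0)

/-- Dual candidate `b̃^III_{lmn}` on the tetrahedron. -/
noncomputable def btTetIII (l m n : ℕ) (p : ℝ × ℝ × ℝ) : ℝ × ℝ × ℝ :=
  (-(((l:ℝ) + 1) / (2*(l:ℝ))) * jacobiP (l-1) 1 1 (etaT p) * ((1 - chiT p)/2)^(l-1) *
     Qtet1 l m (chiT p) * (((1 - p.2.2)/2)^(l+m-2) * jacobiP (n-1) (2*l+2*m) 0 p.2.2),
   jacobiP (l-2) 1 1 (etaT p) * ((1 - chiT p)/2)^(l-2) * Qtet2 l m (chiT p) *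
     (((1 - p.2.2)/2)^(l+m-2) * jacobiP (n-1) (2*l+2*m) 0 p.2.2),
   jacobiP (l-2) 1 1 (etaT p) * ((1 - chiT p)/2)^(l-2) * jacobiP (m-1) (2*l-1) 1 (chiT p) *
     (((1 - p.2.2)/2)^(l+m-2) * jacobiP (n-1) (2*l+2*m) 0 p.2.2))

/-- The three types of auxiliary `H(curl)` fields / dual candidates. -/
inductive TetType | I | II | III
deriving DecidableEq

/-- The auxiliary `H(curl)` interior fields on the tetrahedron, by type. -/
noncomputable def vtTet : TetType → ℕ → ℕ → ℕ → (ℝ × ℝ × ℝ) → ℝ × ℝ × ℝ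
  | .I => vtTetI
  | .II => vtTetII
  | .III => vtTetIII

/-- The dual candidates on the tetrahedron, by type. -/
noncomputable def btTet : TetType → ℕ → ℕ → ℕ → (ℝ × ℝ × ℝ) → ℝ × ℝ × ℝ
  | .I => btTetI
  | .II => btTetII
  | .III => btTetIII

/-- The lowest-order Nédélec-type `H(curl)` shape functions `v^IV_{jk}` on the
tetrahedron. -/
noncomputable def vTetIV (j k : ℕ) (p : ℝ × ℝ × ℝ) : ℝ × ℝ × ℝ :=
  (((1 - chiT p)/2) * intJacobiP j 1 (chiT p) * ((1 - p.2.2)/2)^(j+1) *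
     intJacobiP k (2*j+3) p.2.2,
   (etaT p/2) * (((1 - chiT p)/2) * intJacobiP j 1 (chiT p) * ((1 - p.2.2)/2)^(j+1) *
     intJacobiP k (2*j+3) p.2.2),
   (etaT p/4) * (((1 - chiT p)/2) * intJacobiP j 1 (chiT p) * ((1 - p.2.2)/2)^(j+1) *
     intJacobiP k (2*j+3) p.2.2))

open Polynomial in
lemma aux_iter (p : ℝ[X]) (n : ℕ) :
    iteratedDeriv n (fun t : ℝ => p.eval t) = fun x => (derivative^[n] p).eval x := by
  induction n with
  | zero => simp
  | succ n ih =>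
    rw [iteratedDeriv_succ, ih, Function.iterate_succ_apply']
    funext x
    exact Polynomial.deriv _

open Polynomial in
lemma aux_leg (n : ℕ) (x : ℝ) :
    legendreP n x = 1 / ((2:ℝ)^n * (Nat.factorial n : ℝ)) *
      (derivative^[n] ((X^2 - 1 : ℝ[X])^n)).eval x := by
  have h := congrFun (aux_iter ((X^2 - 1 : ℝ[X])^n) n) x
  simp only [eval_pow, eval_sub, eval_X, eval_one] at h
  simp only [legendreP, jacobiP, pow_zero, one_mul, mul_one]
  rw [h]

open Polynomial in
lemma aux_jac (n : ℕ) (x : ℝ) :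
    jacobiP n 1 1 x = 1 / ((2:ℝ)^n * (Nat.factorial n : ℝ) * (1 - x) * (1 + x)) *
      -(derivative^[n] ((X^2 - 1 : ℝ[X])^(n+1))).eval x := by
  have h := congrFun (aux_iter (-(X^2 - 1 : ℝ[X])^(n+1)) n) x
  have e : (fun t : ℝ => eval t (-(X^2 - 1 : ℝ[X])^(n+1))) =
      (fun t : ℝ => (1 - t)^1 * (1 + t)^1 * (t^2 - 1)^n) := by
    funext t
    simp only [eval_pow, eval_sub, eval_X, eval_one, eval_neg]
    ring
  rw [e] at h
  rw [jacobiP, h, iterate_derivative_neg, eval_neg, pow_one, pow_one]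

open Polynomial in
lemma aux_poly (r : ℕ) :
    ((r:ℝ[X]) + 3) * derivative^[r+1] ((X^2 - 1 : ℝ[X])^(r+2)) =
      2 * ((r:ℝ[X]) + 2) * (X^2 - 1) * derivative^[r+1] ((X^2 - 1 : ℝ[X])^(r+1)) +
      2 * ((r:ℝ[X]) + 1) * ((r:ℝ[X]) + 2) * X * derivative^[r] ((X^2 - 1 : ℝ[X])^(r+1)) := by
  have A : derivative^[r+1] ((X^2 - 1 : ℝ[X])^(r+2)) =
      (derivative^[r+1] ((X^2 - 1 : ℝ[X])^(r+1)) * X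
        + ((r:ℝ[X])+1) * derivative^[r] ((X^2 - 1 : ℝ[X])^(r+1))) * X
      + ((r:ℝ[X])+1) * (derivative^[r] ((X^2 - 1 : ℝ[X])^(r+1)) * X
        + (r:ℝ[X]) * derivative^[r-1] ((X^2 - 1 : ℝ[X])^(r+1)))
      - derivative^[r+1] ((X^2 - 1 : ℝ[X])^(r+1)) := by
    have e : (X^2 - 1 : ℝ[X])^(r+2) = (X^2 - 1 : ℝ[X])^(r+1) * X * X - (X^2 - 1 : ℝ[X])^(r+1) := by
      ring
    rw [e, iterate_derivative_sub, iterate_derivative_mul_X, iterate_derivative_mul_X,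
      Nat.add_sub_cancel, iterate_derivative_mul_X]
    simp only [nsmul_eq_mul]
    push_cast
    ring
  have B : derivative^[r+1] ((X^2 - 1 : ℝ[X])^(r+2)) =
      2 * ((r:ℝ[X]) + 2) * (derivative^[r] ((X^2 - 1 : ℝ[X])^(r+1)) * X
        + (r:ℝ[X]) * derivative^[r-1] ((X^2 - 1 : ℝ[X])^(r+1))) := by
    have e : derivative ((X^2 - 1 : ℝ[X])^(r+2)) =
        ((2 * (r + 2) : ℕ) : ℝ[X]) * ((X^2 - 1 : ℝ[X])^(r+1) * X) := by
      have hC : (C 2 : ℝ[X]) = 2 := rfl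
      rw [derivative_pow]
      simp [hC]
      ring
    rw [Function.iterate_succ_apply, e, iterate_derivative_natCast_mul, iterate_derivative_mul_X]
    simp only [nsmul_eq_mul]
    push_cast
    ring
  linear_combination 2 * ((r:ℝ[X]) + 2) * A - ((r:ℝ[X]) + 1) * B

/-- Key identity. -/
lemma aux_key (r : ℕ) (x : ℝ) (h1 : -1 < x) (h2 : x < 1) :
    ((r:ℝ) + 3) * jacobiP (r+1) 1 1 x - ((r:ℝ) + 2) * x * jacobiP r 1 1 x =
      2 * ((r:ℝ) + 2) * legendreP (r+1) x := by
  have h := congrArg (Polynomial.eval x) (aux_poly r)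
  simp only [Polynomial.eval_mul, Polynomial.eval_add, Polynomial.eval_sub, Polynomial.eval_pow,
    Polynomial.eval_X, Polynomial.eval_one, Polynomial.eval_natCast, Polynomial.eval_ofNat] at h
  rw [aux_jac, aux_jac, aux_leg, Nat.factorial_succ]
  have a1 : (1 - x) ≠ 0 := by linarith
  have a2 : (1 + x) ≠ 0 := by linarith
  have a3 : (Nat.factorial r : ℝ) ≠ 0 := by positivity
  have a4 : ((r:ℝ) + 1) ≠ 0 := by positivity
  push_cast
  revert h
  generalize Polynomial.eval x (Polynomial.derivative^[r + 1] ((Polynomial.X ^ 2 - 1) ^ (r + 2))) = A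
  generalize Polynomial.eval x (Polynomial.derivative^[r + 1] ((Polynomial.X ^ 2 - 1) ^ (r + 1))) = B
  generalize Polynomial.eval x (Polynomial.derivative^[r] ((Polynomial.X ^ 2 - 1) ^ (r + 1))) = D
  intro h
  have a5 : (2:ℝ)^r ≠ 0 := by positivity
  rw [pow_succ]
  generalize (2:ℝ)^r = T at *
  field_simp
  linear_combination (-1) * h

open Polynomial in
lemma aux_int (r : ℕ) : ∫ x in (-1:ℝ)..1, legendreP (r+1) x = 0 := by
  simp only [aux_leg]
  rw [intervalIntegral.integral_const_mul]
  have hd : ∀ x ∈ Set.uIcc (-1:ℝ) 1,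
      HasDerivAt (fun t => (derivative^[r] ((X^2 - 1 : ℝ[X])^(r+1))).eval t)
        ((derivative^[r+1] ((X^2 - 1 : ℝ[X])^(r+1))).eval x) x := by
    intro x _
    rw [Function.iterate_succ_apply']
    exact Polynomial.hasDerivAt _ _
  rw [intervalIntegral.integral_eq_sub_of_hasDerivAt hd
    ((Polynomial.continuous _).intervalIntegrable _ _)]
  have hdv : (X^2 - 1 : ℝ[X]) ∣ derivative^[r] ((X^2 - 1 : ℝ[X])^(r+1)) := by
    have := pow_sub_dvd_iterate_derivative_pow (X^2 - 1 : ℝ[X]) (r+1) r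
    simpa using this
  obtain ⟨q, hq⟩ := hdv
  rw [hq]
  simp

lemma aux_main (r : ℕ) (f : ℝ × ℝ × ℝ → ℝ) (C : ℝ × ℝ → ℝ)
    (hf : ∀ p ∈ Tet, f p = C p.2 * legendreP (r+1) (etaT p)) : ∫ p in Tet, f p = 0 := by
  have hm : MeasurableSet Tet := by
    apply IsOpen.measurableSet
    unfold Tet
    have o1 : IsOpen {p : ℝ × ℝ × ℝ | -1 < p.2.2} := isOpen_lt (by fun_prop) (by fun_prop)
    have o2 : IsOpen {p : ℝ × ℝ × ℝ | p.2.2 < 1} := isOpen_lt (by fun_prop) (by fun_prop)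
    have o3 : IsOpen {p : ℝ × ℝ × ℝ | |p.2.1| < (1 - p.2.2) / 2} :=
      isOpen_lt (by fun_prop) (by fun_prop)
    have o4 : IsOpen {p : ℝ × ℝ × ℝ | |p.1| < (1 - 2*p.2.1 - p.2.2) / 4} :=
      isOpen_lt (by fun_prop) (by fun_prop)
    exact o1.inter (o2.inter (o3.inter o4))
  rw [← integral_indicator hm]
  by_cases hi : Integrable (Tet.indicator f)
  swap
  · exact integral_undef hi
  rw [Measure.volume_eq_prod] at hi ⊢
  rw [integral_prod_symm _ hi]
  refine integral_eq_zero_of_ae (Filter.Eventually.of_forall ?_)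
  rintro ⟨y, z⟩
  simp only [Pi.zero_apply]
  by_cases hyz : -1 < z ∧ z < 1 ∧ |y| < (1 - z) / 2
  swap
  · have : ∀ x, Tet.indicator f (x, y, z) = 0 := by
      intro x
      apply Set.indicator_of_notMem
      rintro ⟨h1, h2, h3, _⟩
      exact hyz ⟨h1, h2, h3⟩
    simp [this]
  obtain ⟨h1, h2, h3⟩ := hyz
  have h4 := (abs_lt.1 h3).2
  set a : ℝ := (1 - 2*y - z) / 4 with ha
  have ha0 : 0 < a := by rw [ha]; linarith
  have e : (fun x => Tet.indicator f (x, y, z)) =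
      (Set.Ioo (-a) a).indicator (fun x => C (y, z) * legendreP (r+1) (x / a)) := by
    funext x
    by_cases hx : |x| < a
    · have hT : (x, y, z) ∈ Tet := ⟨h1, h2, h3, hx⟩
      rw [Set.indicator_of_mem hT, Set.indicator_of_mem (show x ∈ Set.Ioo (-a) a from abs_lt.1 hx), hf _ hT]
      have : etaT (x, y, z) = x / a := by
        have : 1 - 2*y - z ≠ 0 := by linarith
        simp only [etaT, ha]
        field_simp
      rw [this]
    · rw [Set.indicator_of_notMem, Set.indicator_of_notMem]
      · exact fun h => hx (abs_lt.2 h)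
      · exact fun h => hx h.2.2.2
  rw [e, integral_indicator measurableSet_Ioo, ← integral_Ioc_eq_integral_Ioo,
    ← intervalIntegral.integral_of_le (by linarith), intervalIntegral.integral_const_mul,
    intervalIntegral.integral_comp_div _ ha0.ne', neg_div, div_self ha0.ne', aux_int]
  simp

lemma aux_eta (p : ℝ × ℝ × ℝ) (hp : p ∈ Tet) : -1 < etaT p ∧ etaT p < 1 := by
  obtain ⟨h1, h2, h3, h4⟩ := hp
  have := (abs_lt.1 h3).2
  have hx := abs_lt.1 h4
  have hpos : 0 < 1 - 2*p.2.1 - p.2.2 := by linarith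
  unfold etaT
  rw [lt_div_iff₀ hpos, div_lt_iff₀ hpos]
  constructor <;> linarith

/-- The Nédélec-type shape functions are orthogonal to all dual candidates. -/
theorem tetrahedron_Hcurl_nedelec_orthogonal (j k l m n : ℕ) (s : TetType)
    (hj : 1 ≤ j) (hk : 1 ≤ k) (hl : 2 ≤ l) (hm : 1 ≤ m) (hn : 1 ≤ n) :
    ∫ p in Tet, dot3 (vTetIV j k p) (btTet s l m n p) = 0 := by
  obtain ⟨r, rfl⟩ : ∃ r, l = r + 2 := ⟨l - 2, by omega⟩
  cases s with
  | I =>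
    refine aux_main r _ (fun q => (((1 - 2*q.1/(1-q.2))/2) * intJacobiP j 1 (2*q.1/(1-q.2)) *
      ((1 - q.2)/2)^(j+1) * intJacobiP k (2*j+3) q.2) *
      (((1 - 2*q.1/(1-q.2))/2)^(r+1) * jacobiP (m-1) (2*(r+2)-1) 1 (2*q.1/(1-q.2)) *
     (((1 - q.2)/2)^(r+2+m-2) * jacobiP (n-1) (2*(r+2)+2*m-1) 1 q.2))) ?_
    intro p hp
    simp only [btTet, btTetI, vTetIV, dot3, chiT, show r + 2 - 1 = r + 1 by omega]
    ring
  | II =>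
    refine aux_main r _ (fun q => (((1 - 2*q.1/(1-q.2))/2) * intJacobiP j 1 (2*q.1/(1-q.2)) *
      ((1 - q.2)/2)^(j+1) * intJacobiP k (2*j+3) q.2) *
      (((1 - 2*q.1/(1-q.2))/2)^(r+1) * jacobiP (m-1) (2*(r+2)) 0 (2*q.1/(1-q.2)) *
     (((1 - q.2)/2)^(r+2+m-2) * jacobiP (n-1) (2*(r+2)+2*m-1) 1 q.2)) * (2 * ((r:ℝ) + 2))) ?_
    intro p hp
    obtain ⟨h1, h2⟩ := aux_eta p hp
    have hk := aux_key r _ h1 h2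
    rw [mul_assoc _ (2 * ((r:ℝ) + 2)), ← hk]
    simp only [btTet, btTetII, vTetIV, dot3, chiT, show r + 2 - 1 = r + 1 by omega,
      show r + 2 - 2 = r by omega]
    push_cast
    ring
  | III =>
    refine aux_main r _ (fun q => (((1 - 2*q.1/(1-q.2))/2) * intJacobiP j 1 (2*q.1/(1-q.2)) *
      ((1 - q.2)/2)^(j+1) * intJacobiP k (2*j+3) q.2) *
      (((1 - 2*q.1/(1-q.2))/2)^(r+1) * Qtet1 (r+2) m (2*q.1/(1-q.2)) *
     (((1 - q.2)/2)^(r+2+m-2) * jacobiP (n-1) (2*(r+2)+2*m) 0 q.2)) *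
      (-1 / (2 * ((r:ℝ) + 2))) * (2 * ((r:ℝ) + 2))) ?_
    intro p hp
    obtain ⟨h1, h2⟩ := aux_eta p hp
    have hk := aux_key r _ h1 h2
    rw [mul_assoc _ (2 * ((r:ℝ) + 2)), ← hk]
    simp only [btTet, btTetIII, vTetIV, dot3, chiT, show r + 2 - 1 = r + 1 by omega,
      show r + 2 - 2 = r by omega, Qtet1, Qtet2]
    have a4 : ((r:ℝ) + 2) ≠ 0 := by positivity
    generalize 2 * p.2.1 / (1 - p.2.2) = c
    generalize ((m:ℝ) / (2*((r+2 : ℕ):ℝ) + (m:ℝ) - 1)) = d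
    generalize ((1 - p.2.2)/2)^(r+2+m-2) = u
    generalize ((1 - p.2.2)/2)^(j+1) = v
    generalize etaT p = e
    push_cast
    field_simp
    ring
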